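/- For every constant c ≥ 0 there exists a constant C > 0 such that for all integers n ≥ 1 and m with n ≤ m ≤ n + c·√n, the price of envy-freeness satisfies p_envy(n,m) ≤ C·√n. -/

import Mathlib

open Finset

/-- A utility matrix for `n` agents and `m` items: `x i j` is the (nonnegative)
utility of agent `j` for item `i`, and each agent's utilities sum to `1`. -/
def IsUtilMatrix (n m : ℕ) (x : Fin m → Fin n → ℝ) : Prop :=
  (∀ i j, 0 ≤ x i j) ∧ (∀ j, ∑ i, x i j = 1)

/-- The utility that agent `j` assigns to the bundle of items allocated to
agent `j'` by the allocation `A`. -/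
def bundleUtil {n m : ℕ} (x : Fin m → Fin n → ℝ) (A : Fin m → Fin n)
    (j j' : Fin n) : ℝ :=
  ∑ i ∈ Finset.univ.filter (fun i => A i = j'), x i j

/-- The allocation `A` is envy-free: no agent values another agent's bundle
more than its own. -/
def EnvyFree {n m : ℕ} (x : Fin m → Fin n → ℝ) (A : Fin m → Fin n) : Prop :=
  ∀ j j', bundleUtil x A j j ≥ bundleUtil x A j j'

/-- The welfare of allocation `A`: the sum of the agents' utilities for
their own bundles. -/
def welfare {n m : ℕ} (x : Fin m → Fin n → ℝ) (A : Fin m → Fin n) : ℝ :=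
  ∑ j, bundleUtil x A j j

/-- Optimal welfare over all allocations. -/
noncomputable def uStar (n m : ℕ) (x : Fin m → Fin n → ℝ) : ℝ :=
  sSup {w : ℝ | ∃ A : Fin m → Fin n, w = welfare x A}

/-- Optimal welfare over all envy-free allocations. -/
noncomputable def uStarF (n m : ℕ) (x : Fin m → Fin n → ℝ) : ℝ :=
  sSup {w : ℝ | ∃ A : Fin m → Fin n, EnvyFree x A ∧ w = welfare x A}

/-- The price of envy-freeness for `n` agents and `m` items: the supremum of
`uStar x / uStarF x` over all utility matrices admitting an envy-free
allocation. -/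
noncomputable def pEnvy (n m : ℕ) : ℝ :=
  sSup {r : ℝ | ∃ x : Fin m → Fin n → ℝ, IsUtilMatrix n m x ∧
    (∃ A : Fin m → Fin n, EnvyFree x A) ∧ r = uStar n m x / uStarF n m x}

lemma bundleUtil_nonneg {n m : ℕ} {x : Fin m → Fin n → ℝ} (hx : IsUtilMatrix n m x)
    (A : Fin m → Fin n) (j j' : Fin n) : 0 ≤ bundleUtil x A j j' :=
  Finset.sum_nonneg fun i _ => hx.1 i j

lemma sum_bundleUtil {n m : ℕ} {x : Fin m → Fin n → ℝ} (hx : IsUtilMatrix n m x)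
    (A : Fin m → Fin n) (j : Fin n) : ∑ j', bundleUtil x A j j' = 1 := by
  rw [← hx.2 j]
  exact Finset.sum_fiberwise _ _ _

lemma bundleUtil_le_one {n m : ℕ} {x : Fin m → Fin n → ℝ} (hx : IsUtilMatrix n m x)
    (A : Fin m → Fin n) (j j' : Fin n) : bundleUtil x A j j' ≤ 1 := by
  rw [← sum_bundleUtil hx A j]
  exact Finset.single_le_sum (fun k _ => bundleUtil_nonneg hx A j k) (Finset.mem_univ j')

lemma EnvyFree.utility_le {n m : ℕ} {x : Fin m → Fin n → ℝ} (hx : IsUtilMatrix n m x)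
    {A : Fin m → Fin n} (hA : EnvyFree x A) (i : Fin m) (j : Fin n) :
    x i j ≤ bundleUtil x A j j :=
  calc x i j ≤ bundleUtil x A j (A i) :=
        Finset.single_le_sum (f := fun k => x k j) (fun k _ => hx.1 k j)
          (Finset.mem_filter.2 ⟨Finset.mem_univ i, rfl⟩)
    _ ≤ bundleUtil x A j j := hA j (A i)

lemma EnvyFree.one_le_welfare {n m : ℕ} {x : Fin m → Fin n → ℝ} (hx : IsUtilMatrix n m x)
    {A : Fin m → Fin n} (hA : EnvyFree x A) (hn : 1 ≤ n) : 1 ≤ welfare x A := by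
  have hn' : (0 : ℝ) < n := by exact_mod_cast hn
  have h : ∀ j, 1 ≤ (n : ℝ) * bundleUtil x A j j := fun j => by
    calc (1 : ℝ) = ∑ j', bundleUtil x A j j' := (sum_bundleUtil hx A j).symm
      _ ≤ ∑ _j' : Fin n, bundleUtil x A j j := Finset.sum_le_sum fun j' _ => hA j j'
      _ = n * bundleUtil x A j j := by simp
  have hsum : (n : ℝ) * 1 ≤ n * welfare x A := by
    calc (n : ℝ) * 1 = ∑ _j : Fin n, (1 : ℝ) := by simp
      _ ≤ ∑ j, (n : ℝ) * bundleUtil x A j j := Finset.sum_le_sum fun j _ => h j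
      _ = n * welfare x A := by rw [welfare, Finset.mul_sum]
  exact le_of_mul_le_mul_left hsum hn'

/-- Every allocation `O` has welfare at most `√m` times the square root of the welfare of any
envy-free allocation `A`: agent `j` gets from `O` at most `min 1 (k * u)`, where `k` is the number
of items it receives in `O` and `u` is its utility in `A`; conclude by Cauchy-Schwarz. -/
lemma EnvyFree.welfare_le_sqrt_mul_sqrt {n m : ℕ} {x : Fin m → Fin n → ℝ}
    (hx : IsUtilMatrix n m x) {A : Fin m → Fin n} (hA : EnvyFree x A) (O : Fin m → Fin n) :
    welfare x O ≤ √m * √(welfare x A) := by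
  have hcard : ∑ j : Fin n, (#{i | O i = j} : ℝ) = m := by
    have h := Finset.card_eq_sum_card_fiberwise (f := O) (s := univ) (t := univ)
      fun _ _ => Finset.mem_coe.2 (Finset.mem_univ _)
    rw [Finset.card_univ, Fintype.card_fin] at h
    exact_mod_cast h.symm
  calc welfare x O ≤ ∑ j, √(#{i | O i = j} : ℝ) * √(bundleUtil x A j j) := by
        refine Finset.sum_le_sum fun j _ => ?_
        have h0 := bundleUtil_nonneg hx O j j
        have h1 := bundleUtil_le_one hx O j j
        have h2 : bundleUtil x O j j ≤ (#{i | O i = j} : ℝ) * bundleUtil x A j j := by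
          rw [← nsmul_eq_mul]
          exact Finset.sum_le_card_nsmul _ _ _ fun i _ => hA.utility_le hx i j
        rw [← Real.sqrt_mul (Nat.cast_nonneg _)]
        exact Real.le_sqrt_of_sq_le (by nlinarith)
    _ ≤ √(∑ j : Fin n, (#{i | O i = j} : ℝ)) * √(∑ j, bundleUtil x A j j) :=
        Real.sum_sqrt_mul_sqrt_le _ (fun _ => Nat.cast_nonneg _)
          (fun j => bundleUtil_nonneg hx A j j)
    _ = √m * √(welfare x A) := by rw [hcard, welfare]

lemma EnvyFree.welfare_le_uStarF {n m : ℕ} {x : Fin m → Fin n → ℝ}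
    {A : Fin m → Fin n} (hA : EnvyFree x A) : welfare x A ≤ uStarF n m x := by
  refine le_csSup ?_ ⟨A, hA, rfl⟩
  refine ((Set.finite_range (welfare x)).subset ?_).bddAbove
  rintro w ⟨B, -, rfl⟩
  exact ⟨B, rfl⟩

lemma uStar_div_uStarF_le_sqrt {n m : ℕ} {x : Fin m → Fin n → ℝ} (hn : 1 ≤ n)
    (hx : IsUtilMatrix n m x) (hex : ∃ A : Fin m → Fin n, EnvyFree x A) :
    uStar n m x / uStarF n m x ≤ √m := by
  obtain ⟨A, hA⟩ := hex
  have hone := hA.one_le_welfare hx hn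
  have hle := hA.welfare_le_uStarF
  have hW : √(welfare x A) ≤ uStarF n m x :=
    (Real.sqrt_le_iff.2 ⟨by linarith, by nlinarith⟩ : √(welfare x A) ≤ welfare x A).trans hle
  rw [div_le_iff₀ (by linarith)]
  refine Real.sSup_le ?_ (mul_nonneg (Real.sqrt_nonneg _) (by linarith))
  rintro w ⟨O, rfl⟩
  exact (hA.welfare_le_sqrt_mul_sqrt hx O).trans
    (mul_le_mul_of_nonneg_left hW (Real.sqrt_nonneg _))

theorem pEnvy_le_sqrt {n : ℕ} (m : ℕ) (hn : 1 ≤ n) : pEnvy n m ≤ √m := by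
  refine Real.sSup_le ?_ (Real.sqrt_nonneg _)
  rintro r ⟨x, hx, hex, rfl⟩
  exact uStar_div_uStarF_le_sqrt hn hx hex

/-- For every constant `c ≥ 0` there is a constant `C > 0` such that for all
`n ≥ 1` and `n ≤ m ≤ n + c·√n`, the price of envy-freeness satisfies
`p_envy(n,m) ≤ C·√n`. -/
theorem pEnvy_upper_bound_few_items (c : ℝ) (hc : 0 ≤ c) :
    ∃ C : ℝ, 0 < C ∧ ∀ n m : ℕ, 1 ≤ n → n ≤ m →
      (m : ℝ) ≤ (n : ℝ) + c * Real.sqrt n →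
      pEnvy n m ≤ C * Real.sqrt n := by
  refine ⟨√(1 + c), Real.sqrt_pos.2 (by linarith), fun n m hn _ hm => ?_⟩
  refine (pEnvy_le_sqrt m hn).trans ?_
  rw [← Real.sqrt_mul (by linarith)]
  refine Real.sqrt_le_sqrt ?_
  have hn' : (1 : ℝ) ≤ n := by exact_mod_cast hn
  have hs : √(n : ℝ) ≤ n := Real.sqrt_le_iff.2 ⟨by linarith, by nlinarith⟩
  nlinarith [mul_le_mul_of_nonneg_left hs hc]
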